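/- (Newton equation as a Lyapunov equation.) Let P be a symmetric n×n real matrix with Q_uu + BᵀPB invertible and set K^N = K(P). A symmetric matrix X satisfies the Newton equation R′(P, X - P) = -R(P) (with R′ the directional derivative of the Riccati operator) if and only if X satisfies the Lyapunov equation X = (A + BK^N)ᵀ X (A + BK^N) + [I;K^N]ᵀ Q [I;K^N]. -/

import Mathlib

open Matrix

attribute [local instance] Matrix.normedAddCommGroup Matrix.normedSpace

/-- The LQR gain operator `K(P) = -(Q_uu + BᵀPB)⁻¹ (Q_ux + BᵀPA)`. -/
noncomputable def gainK {n m : ℕ} (A : Matrix (Fin n) (Fin n) ℝ) (B : Matrix (Fin n) (Fin m) ℝ)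
    (Qux : Matrix (Fin m) (Fin n) ℝ) (Quu : Matrix (Fin m) (Fin m) ℝ)
    (P : Matrix (Fin n) (Fin n) ℝ) : Matrix (Fin m) (Fin n) ℝ :=
  -(Quu + Bᵀ * P * B)⁻¹ * (Qux + Bᵀ * P * A)

/-- The Riccati operator
`R(P) = -P + Q_xx + AᵀPA - (Q_xu + AᵀPB)(Q_uu + BᵀPB)⁻¹(Q_ux + BᵀPA)`. -/
noncomputable def Ricc {n m : ℕ} (A : Matrix (Fin n) (Fin n) ℝ) (B : Matrix (Fin n) (Fin m) ℝ)
    (Qxx : Matrix (Fin n) (Fin n) ℝ) (Qxu : Matrix (Fin n) (Fin m) ℝ)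
    (Qux : Matrix (Fin m) (Fin n) ℝ) (Quu : Matrix (Fin m) (Fin m) ℝ)
    (P : Matrix (Fin n) (Fin n) ℝ) : Matrix (Fin n) (Fin n) ℝ :=
  -P + Qxx + Aᵀ * P * A -
    (Qxu + Aᵀ * P * B) * (Quu + Bᵀ * P * B)⁻¹ * (Qux + Bᵀ * P * A)

/-- The directional derivative `R′(P, X) = lim_{ε → 0} (R(P + εX) - R(P))/ε` of the Riccati
operator at `P` in direction `X`, realized as the derivative of `ε ↦ R(P + εX)` at `ε = 0`. -/
noncomputable def RiccDer {n m : ℕ} (A : Matrix (Fin n) (Fin n) ℝ) (B : Matrix (Fin n) (Fin m) ℝ)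
    (Qxx : Matrix (Fin n) (Fin n) ℝ) (Qxu : Matrix (Fin n) (Fin m) ℝ)
    (Qux : Matrix (Fin m) (Fin n) ℝ) (Quu : Matrix (Fin m) (Fin m) ℝ)
    (P X : Matrix (Fin n) (Fin n) ℝ) : Matrix (Fin n) (Fin n) ℝ :=
  deriv (fun ε : ℝ => Ricc A B Qxx Qxu Qux Quu (P + ε • X)) 0

/-- The stacked matrix `[I; K] ∈ ℝ^{(n+m)×n}`. -/
def stackIK {n m : ℕ} (K : Matrix (Fin m) (Fin n) ℝ) : Matrix (Fin n ⊕ Fin m) (Fin n) ℝ :=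
  fromRows (1 : Matrix (Fin n) (Fin n) ℝ) K

/-- The closed-loop Lyapunov residual `-P + (A+BK)ᵀ P (A+BK) + [I;K]ᵀ Q [I;K]`, with the blocks of
`Q` written out. -/
def lyapunovResidual {n m : ℕ} (A : Matrix (Fin n) (Fin n) ℝ) (B : Matrix (Fin n) (Fin m) ℝ)
    (Qxx : Matrix (Fin n) (Fin n) ℝ) (Qxu : Matrix (Fin n) (Fin m) ℝ)
    (Quu : Matrix (Fin m) (Fin m) ℝ) (K : Matrix (Fin m) (Fin n) ℝ)
    (P : Matrix (Fin n) (Fin n) ℝ) : Matrix (Fin n) (Fin n) ℝ :=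
  -P + (A + B * K)ᵀ * P * (A + B * K) + (Qxx + Qxu * K + Kᵀ * Qxuᵀ + Kᵀ * Quu * K)

theorem stackIK_transpose_mul_fromBlocks_mul {n m : ℕ}
    (Qxx : Matrix (Fin n) (Fin n) ℝ) (Qxu : Matrix (Fin n) (Fin m) ℝ)
    (Qux : Matrix (Fin m) (Fin n) ℝ) (Quu : Matrix (Fin m) (Fin m) ℝ)
    (K : Matrix (Fin m) (Fin n) ℝ) :
    (stackIK K)ᵀ * fromBlocks Qxx Qxu Qux Quu * stackIK K =
      Qxx + Qxu * K + Kᵀ * Qux + Kᵀ * Quu * K := by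
  rw [stackIK, transpose_fromRows, fromCols_mul_fromBlocks, fromCols_mul_fromRows]
  simp only [transpose_one, Matrix.one_mul, Matrix.mul_one, Matrix.add_mul]
  abel

/-- Completion of squares: the Riccati operator is the Lyapunov residual of an arbitrary gain `K`
minus a square. -/
theorem ricc_eq_lyapunovResidual_sub {n m : ℕ}
    (A : Matrix (Fin n) (Fin n) ℝ) (B : Matrix (Fin n) (Fin m) ℝ)
    (Qxx : Matrix (Fin n) (Fin n) ℝ) (Qxu : Matrix (Fin n) (Fin m) ℝ)
    {Quu : Matrix (Fin m) (Fin m) ℝ} (hQuu : Quuᵀ = Quu)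
    {P : Matrix (Fin n) (Fin n) ℝ} (hP : Pᵀ = P) (hinv : IsUnit (Quu + Bᵀ * P * B))
    (K : Matrix (Fin m) (Fin n) ℝ) :
    Ricc A B Qxx Qxu Qxuᵀ Quu P = lyapunovResidual A B Qxx Qxu Quu K P -
      ((Quu + Bᵀ * P * B) * K + (Qxuᵀ + Bᵀ * P * A))ᵀ * (Quu + Bᵀ * P * B)⁻¹ *
        ((Quu + Bᵀ * P * B) * K + (Qxuᵀ + Bᵀ * P * A)) := by
  have hres : lyapunovResidual A B Qxx Qxu Quu K P = -P + Qxx + Aᵀ * P * A +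
      (Kᵀ * (Qxuᵀ + Bᵀ * P * A) + (Qxu + Aᵀ * P * B) * K + Kᵀ * (Quu + Bᵀ * P * B) * K) := by
    simp only [lyapunovResidual, transpose_add, transpose_mul, Matrix.mul_add, Matrix.add_mul,
      Matrix.mul_assoc]
    abel
  have hG : (Quu + Bᵀ * P * B)ᵀ = Quu + Bᵀ * P * B := by
    simp [transpose_mul, hP, hQuu, Matrix.mul_assoc]
  have hH : (Qxuᵀ + Bᵀ * P * A)ᵀ = Qxu + Aᵀ * P * B := by
    simp [transpose_mul, hP, Matrix.mul_assoc]
  rw [hres, Ricc, ← hH]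
  generalize Quu + Bᵀ * P * B = G at *
  generalize Qxuᵀ + Bᵀ * P * A = H
  have hdet : IsUnit G.det := (isUnit_iff_isUnit_det G).1 hinv
  simp only [transpose_add, transpose_mul, hG, Matrix.mul_add, Matrix.add_mul, Matrix.mul_assoc,
    mul_nonsing_inv_cancel_left _ _ hdet, nonsing_inv_mul_cancel_left _ _ hdet]
  abel

theorem hasDerivAt_zero_sq_smul {E : Type*} [NormedAddCommGroup E] [NormedSpace ℝ E]
    {W : ℝ → E} (hW : ContinuousAt W 0) : HasDerivAt (fun ε : ℝ => ε ^ 2 • W ε) 0 0 := by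
  rw [hasDerivAt_iff_tendsto_slope]
  have h : Filter.Tendsto (fun ε : ℝ => ε • W ε) (nhdsWithin 0 {0}ᶜ) (nhds 0) := by
    have hc : ContinuousAt (fun ε : ℝ => ε • W ε) 0 := continuousAt_id.smul hW
    simpa using hc.tendsto.mono_left (nhdsWithin_le_nhds (s := ({0}ᶜ : Set ℝ)))
  refine h.congr' ?_
  filter_upwards [self_mem_nhdsWithin] with ε hε
  have hε0 : ε ≠ 0 := hε
  simp only [slope_def_module, sub_zero, ne_eq, OfNat.ofNat_ne_zero, not_false_eq_true, zero_pow,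
    zero_smul, smul_smul]
  congr 1
  field_simp

theorem Matrix.continuousAt_inv_of_isUnit {m : ℕ} {G : Matrix (Fin m) (Fin m) ℝ}
    (hG : IsUnit G) : ContinuousAt (fun M : Matrix (Fin m) (Fin m) ℝ => M⁻¹) G := by
  have hdet : G.det ≠ 0 := ((isUnit_iff_isUnit_det G).1 hG).ne_zero
  simp only [inv_def, Ring.inverse_eq_inv']
  exact ((continuous_id.matrix_det.continuousAt).inv₀ hdet).smul
    continuous_id.matrix_adjugate.continuousAt

/-- The directional derivative of the Riccati operator in a symmetric direction `D`. -/
theorem riccDer_eq {n m : ℕ}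
    (A : Matrix (Fin n) (Fin n) ℝ) (B : Matrix (Fin n) (Fin m) ℝ)
    (Qxx : Matrix (Fin n) (Fin n) ℝ) (Qxu : Matrix (Fin n) (Fin m) ℝ)
    {Quu : Matrix (Fin m) (Fin m) ℝ} (hQuu : Quuᵀ = Quu)
    {P : Matrix (Fin n) (Fin n) ℝ} (hP : Pᵀ = P) (hinv : IsUnit (Quu + Bᵀ * P * B))
    {K : Matrix (Fin m) (Fin n) ℝ}
    (hK : (Quu + Bᵀ * P * B) * K + (Qxuᵀ + Bᵀ * P * A) = 0)
    {D : Matrix (Fin n) (Fin n) ℝ} (hD : Dᵀ = D) :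
    RiccDer A B Qxx Qxu Qxuᵀ Quu P D = -D + (A + B * K)ᵀ * D * (A + B * K) := by
  set L := -D + (A + B * K)ᵀ * D * (A + B * K) with hL
  set V := Bᵀ * D * (A + B * K) with hV
  have hGc : Continuous fun ε : ℝ => Quu + Bᵀ * (P + ε • D) * B := by fun_prop
  have hG0 : Quu + Bᵀ * (P + (0 : ℝ) • D) * B = Quu + Bᵀ * P * B := by simp
  have hinvc : ContinuousAt (fun ε : ℝ => (Quu + Bᵀ * (P + ε • D) * B)⁻¹) 0 :=
    ContinuousAt.comp (f := fun ε : ℝ => Quu + Bᵀ * (P + ε • D) * B)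
      (Matrix.continuousAt_inv_of_isUnit (by rwa [hG0])) hGc.continuousAt
  have hW : ContinuousAt (fun ε : ℝ => Vᵀ * (Quu + Bᵀ * (P + ε • D) * B)⁻¹ * V) 0 :=
    ContinuousAt.comp (g := fun M : Matrix (Fin m) (Fin m) ℝ => Vᵀ * M * V)
      (Continuous.continuousAt (by fun_prop)) hinvc
  have hunit : ∀ᶠ ε : ℝ in nhds 0, IsUnit (Quu + Bᵀ * (P + ε • D) * B) := by
    have hne : (Quu + Bᵀ * (P + (0 : ℝ) • D) * B).det ≠ 0 := by
      rw [hG0]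
      exact ((isUnit_iff_isUnit_det _).1 hinv).ne_zero
    filter_upwards [hGc.matrix_det.continuousAt.eventually_ne hne] with ε hε
    exact (isUnit_iff_isUnit_det _).2 hε.isUnit
  have heq : (fun ε : ℝ => Ricc A B Qxx Qxu Qxuᵀ Quu (P + ε • D)) =ᶠ[nhds 0]
      fun ε : ℝ => lyapunovResidual A B Qxx Qxu Quu K P + ε • L -
        ε ^ 2 • (Vᵀ * (Quu + Bᵀ * (P + ε • D) * B)⁻¹ * V) := by
    filter_upwards [hunit] with ε hε
    have hPε : (P + ε • D)ᵀ = P + ε • D := by simp [hP, hD]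
    have hGK : (Quu + Bᵀ * (P + ε • D) * B) * K + (Qxuᵀ + Bᵀ * (P + ε • D) * A) = ε • V := by
      rw [← zero_add (ε • V), ← hK, hV]
      simp only [Matrix.mul_add, Matrix.add_mul, Matrix.mul_assoc, Matrix.mul_smul,
        Matrix.smul_mul, smul_add]
      abel
    have hres : lyapunovResidual A B Qxx Qxu Quu K (P + ε • D) =
        lyapunovResidual A B Qxx Qxu Quu K P + ε • L := by
      simp only [lyapunovResidual, hL, Matrix.mul_add, Matrix.add_mul, Matrix.mul_smul,
        Matrix.smul_mul, smul_add, smul_neg, neg_add]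
      abel
    rw [ricc_eq_lyapunovResidual_sub A B Qxx Qxu hQuu hPε hε K, hGK, hres]
    simp only [transpose_smul, Matrix.smul_mul, Matrix.mul_smul, smul_smul, sq]
  have hlin : HasDerivAt (fun ε : ℝ => lyapunovResidual A B Qxx Qxu Quu K P + ε • L) L 0 := by
    have h := ((hasDerivAt_id (0 : ℝ)).smul_const L).const_add
      (lyapunovResidual A B Qxx Qxu Quu K P)
    rwa [one_smul] at h
  have hder := (hlin.sub (hasDerivAt_zero_sq_smul hW)).congr_of_eventuallyEq heq
  rw [sub_zero] at hder
  exact hder.deriv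

/-- Newton equation as a Lyapunov equation: a symmetric `X` satisfies
`R′(P, X - P) = -R(P)` iff `X = (A+BK^N)ᵀ X (A+BK^N) + [I;K^N]ᵀ Q [I;K^N]`, `K^N = K(P)`. -/
theorem stmt10 {n m : ℕ}
    (A : Matrix (Fin n) (Fin n) ℝ) (B : Matrix (Fin n) (Fin m) ℝ)
    (Qxx : Matrix (Fin n) (Fin n) ℝ) (Qxu : Matrix (Fin n) (Fin m) ℝ)
    (Quu : Matrix (Fin m) (Fin m) ℝ)
    (hQxx : Qxxᵀ = Qxx) (hQuu : Quuᵀ = Quu)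
    (Q : Matrix (Fin n ⊕ Fin m) (Fin n ⊕ Fin m) ℝ)
    (hQ : Q = fromBlocks Qxx Qxu Qxuᵀ Quu)
    (P : Matrix (Fin n) (Fin n) ℝ) (hP : Pᵀ = P)
    (hinv : IsUnit (Quu + Bᵀ * P * B))
    (KN : Matrix (Fin m) (Fin n) ℝ) (hKN : KN = gainK A B Qxuᵀ Quu P)
    (X : Matrix (Fin n) (Fin n) ℝ) (hX : Xᵀ = X) :
    RiccDer A B Qxx Qxu Qxuᵀ Quu P (X - P) = -Ricc A B Qxx Qxu Qxuᵀ Quu P ↔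
      X = (A + B * KN)ᵀ * X * (A + B * KN) + (stackIK KN)ᵀ * Q * stackIK KN := by
  have hdet : IsUnit (Quu + Bᵀ * P * B).det := (isUnit_iff_isUnit_det _).1 hinv
  have hK : (Quu + Bᵀ * P * B) * KN + (Qxuᵀ + Bᵀ * P * A) = 0 := by
    rw [hKN, gainK, Matrix.neg_mul, Matrix.mul_neg, mul_nonsing_inv_cancel_left _ _ hdet,
      neg_add_cancel]
  have hD : (X - P)ᵀ = X - P := by rw [transpose_sub, hX, hP]
  rw [riccDer_eq A B Qxx Qxu hQuu hP hinv hK hD,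
    ricc_eq_lyapunovResidual_sub A B Qxx Qxu hQuu hP hinv KN, hK, hQ,
    stackIK_transpose_mul_fromBlocks_mul, ← sub_eq_zero, ← sub_eq_zero (a := X), ← neg_eq_zero]
  refine Eq.congr ?_ rfl
  simp only [lyapunovResidual, transpose_zero, Matrix.zero_mul, Matrix.mul_sub, Matrix.sub_mul]
  abel
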